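/- Let X be a compact Hausdorff space with at least two distinct points. Then the slice category KH/X is a non-trivial pretopos which is filtral and admits all set-indexed coproducts, but it is not well-pointed. -/

import Mathlib

open CategoryTheory CategoryTheory.Limits Opposite

universe w' w v u

namespace Paper

variable {C : Type u} [Category.{v} C]

/-- "X ≇ 0": the object `X` is not initial. -/
def NonInitial (X : C) : Prop := IsInitial X → False

/-- The category is non-trivial: `0 ≇ 1`, i.e. no object is both initial and terminal. -/
def NonTrivialCat (C : Type u) [Category.{v} C] : Prop :=
  ∀ X : C, IsInitial X → IsTerminal X → False

section Terminal
variable (C) [HasTerminal C]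

/-- The category is well-pointed: the functor of points `pt = Hom(1, -)` is faithful. -/
def WellPointed : Prop :=
  ∀ ⦃X Y : C⦄ (f g : X ⟶ Y), (∀ p : ⊤_ C ⟶ X, p ≫ f = p ≫ g) → f = g

/-- The unique morphism `X ⟶ 1` is a retraction for every `X ≇ 0`. -/
def EnoughPoints : Prop :=
  ∀ X : C, NonInitial X → Nonempty (SplitEpi (terminal.from X))

end Terminal

/-- `b` is the bottom element of `Sub(X)`. -/
def IsBotIn {X : C} (b : Subobject X) : Prop := ∀ S : Subobject X, b ≤ S

/-- `S` is an atom of the subobject lattice `Sub(X)`. -/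
def IsAtomIn {X : C} (S : Subobject X) : Prop :=
  ¬ IsBotIn S ∧ ∀ T : Subobject X, T < S → IsBotIn T

/-- `Sub(X)` is atomic: every subobject is the supremum of the atoms below it. -/
def AtomicSubobjects (X : C) : Prop :=
  ∀ S : Subobject X, IsLUB {A : Subobject X | IsAtomIn A ∧ A ≤ S} S

/-- `S` is a complemented subobject: it has a complement `T` with `S ⊓ T = ⊥`, `S ⊔ T = ⊤`. -/
def IsComplementedSub {X : C} (S : Subobject X) : Prop :=
  ∃ T m : Subobject X, IsGLB {S, T} m ∧ IsBotIn m ∧ IsLUB {S, T} ⊤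

/-- A (non-empty) filter of the Boolean center `B(X)` of `Sub(X)`. -/
structure CenterFilter (X : C) where
  carrier : Set (Subobject X)
  mem_complemented : ∀ S ∈ carrier, IsComplementedSub S
  nonempty : carrier.Nonempty
  inf_mem : ∀ S ∈ carrier, ∀ T ∈ carrier, ∀ m : Subobject X, IsGLB {S, T} m → m ∈ carrier
  mem_of_le : ∀ S ∈ carrier, ∀ T : Subobject X, IsComplementedSub T → S ≤ T → T ∈ carrier

theorem CenterFilter.ext' {X : C} {F G : CenterFilter X} (h : F.carrier = G.carrier) : F = G := by
  cases F; cases G; cases h; rfl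

/-- Filters of the Boolean center, ordered by reverse inclusion. -/
instance (X : C) : PartialOrder (CenterFilter X) where
  le F G := G.carrier ⊆ F.carrier
  le_refl _ := subset_rfl
  le_trans _ _ _ h1 h2 := fun _ hx => h1 (h2 hx)
  le_antisymm _ _ h1 h2 := CenterFilter.ext' (Set.Subset.antisymm h2 h1)

/-- An object `X` is filtral if `Sub(X)` is isomorphic, as a lattice, to the lattice of
non-empty filters of the Boolean center of `Sub(X)`. -/
def FiltralObject (X : C) : Prop :=
  Nonempty (Subobject X ≃o CenterFilter X)

/-- A category is filtral if every object is covered by a filtral one. -/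
def Filtral (C : Type u) [Category.{v} C] : Prop :=
  ∀ Y : C, ∃ (X : C) (f : X ⟶ Y), Nonempty (RegularEpi f) ∧ FiltralObject X

/-- `Sub(X)` is a complete lattice (every subset has an infimum). -/
def MonoCompleteAt (X : C) : Prop :=
  ∀ s : Set (Subobject X), ∃ m : Subobject X, IsGLB s m

/-- The category is mono-complete: every subobject poset is a complete lattice. -/
def MonoComplete (C : Type u) [Category.{v} C] : Prop := ∀ X : C, MonoCompleteAt X

section Points
variable [HasTerminal C]

/-- `Vs S` is the set of points of `X` factoring through the subobject `S`. -/
def Vs {X : C} (S : Subobject X) : Set (⊤_ C ⟶ X) := {p | S.Factors p}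

open Classical in
/-- `Cg T` is the smallest subobject of `X` through which every point in `T` factors
(defined whenever the relevant infimum exists). -/
noncomputable def Cg {X : C} (T : Set (⊤_ C ⟶ X)) : Subobject X :=
  if h : ∃ m : Subobject X, IsGLB {S : Subobject X | ∀ p ∈ T, S.Factors p} m
  then h.choose else ⊤

/-- The closure operator `cl = Vs ∘ Cg` on the power set of `pt X`. -/
noncomputable def cl {X : C} (T : Set (⊤_ C ⟶ X)) : Set (⊤_ C ⟶ X) := Vs (Cg T)

end Points

/-- Images are stable under pullback (together with finite limits and images, this is
the definition of a regular category). -/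
class StableImages (C : Type u) [Category.{v} C] [HasFiniteLimits C] [HasImages C] : Prop where
  image_pullback : ∀ {X Y Z : C} (f : X ⟶ Y) (g : Z ⟶ Y),
    (Subobject.pullback g).obj (imageSubobject f) = imageSubobject (pullback.snd f g)

/-- The extra structure of a coherent category: each `Sub(X)` has finite joins and these
are preserved by the pullback functors. -/
class CoherentJoins (C : Type u) [Category.{v} C] [HasPullbacks C] : Prop where
  exists_bot : ∀ X : C, ∃ b : Subobject X, IsBotIn b
  exists_sup : ∀ {X : C} (S T : Subobject X), ∃ U : Subobject X, IsLUB {S, T} U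
  pullback_bot : ∀ {X Y : C} (f : X ⟶ Y) (b : Subobject Y),
    IsBotIn b → IsBotIn ((Subobject.pullback f).obj b)
  pullback_sup : ∀ {X Y : C} (f : X ⟶ Y) (S T U : Subobject Y), IsLUB {S, T} U →
    IsLUB {(Subobject.pullback f).obj S, (Subobject.pullback f).obj T}
      ((Subobject.pullback f).obj U)

/-- An internal equivalence relation: a jointly-monic pair which is reflexive, symmetric and
transitive (expressed via generalised elements). -/
structure IsEquivRelPair {R X : C} (r₁ r₂ : R ⟶ X) : Prop where
  jointlyMono : ∀ {Z : C} (a b : Z ⟶ R), a ≫ r₁ = b ≫ r₁ → a ≫ r₂ = b ≫ r₂ → a = b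
  refl : ∀ {Z : C} (a : Z ⟶ X), ∃ h : Z ⟶ R, h ≫ r₁ = a ∧ h ≫ r₂ = a
  symm : ∀ {Z : C} (a b : Z ⟶ X), (∃ h : Z ⟶ R, h ≫ r₁ = a ∧ h ≫ r₂ = b) →
    ∃ h : Z ⟶ R, h ≫ r₁ = b ∧ h ≫ r₂ = a
  trans : ∀ {Z : C} (a b c : Z ⟶ X), (∃ h : Z ⟶ R, h ≫ r₁ = a ∧ h ≫ r₂ = b) →
    (∃ h : Z ⟶ R, h ≫ r₁ = b ∧ h ≫ r₂ = c) →
    ∃ h : Z ⟶ R, h ≫ r₁ = a ∧ h ≫ r₂ = c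

/-- Every internal equivalence relation is effective: it is the kernel pair of its
coequaliser. -/
def EffectiveEquivRels (C : Type u) [Category.{v} C] : Prop :=
  ∀ {R X : C} (r₁ r₂ : R ⟶ X), IsEquivRelPair r₁ r₂ →
    ∃ (Y : C) (q : X ⟶ Y) (w : r₁ ≫ q = r₂ ≫ q),
      Nonempty (IsColimit (Cofork.ofπ q w)) ∧ Nonempty (IsLimit (PullbackCone.mk r₁ r₂ w))

/-- An object is decidable if its diagonal is a complemented subobject of `X ⨯ X`. -/
def DecidableObj [HasBinaryProducts C] (X : C) : Prop :=
  ∃ (Y : C) (g : Y ⟶ X ⨯ X), Nonempty (IsColimit (BinaryCofan.mk (diag X) g))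

/-- An object is pro-decidable if it is a codirected (cofiltered) limit of decidable objects. -/
def ProDecidableObj [HasBinaryProducts C] (X : C) : Prop :=
  ∃ (J : Type v) (_ : SmallCategory J) (_ : IsCofiltered J) (D : J ⥤ C) (c : Cone D),
    (∀ j, DecidableObj (D.obj j)) ∧ Nonempty (IsLimit c) ∧ Nonempty (c.pt ≅ X)


section QuotientTopology

open Topology

variable {Y : Type*} [TopologicalSpace Y] [CompactSpace Y] [T2Space Y]

theorem isClosedMap_quotientMk_of_isClosed {s : Setoid Y}
    (hs : IsClosed {p : Y × Y | s p.1 p.2}) : IsClosedMap (Quotient.mk s) := by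
  intro K hK
  rw [← isQuotientMap_quotient_mk'.isClosed_preimage]
  have : Quotient.mk s ⁻¹' (Quotient.mk s '' K) =
      Prod.snd '' ({p : Y × Y | s p.1 p.2} ∩ Prod.fst ⁻¹' K) := by
    ext y
    simp only [Set.mem_preimage, Set.mem_image, Set.mem_inter_iff, Set.mem_ofPred_eq, Prod.exists,
      exists_eq_right]
    exact exists_congr fun x => ⟨fun ⟨hx, h⟩ => ⟨Quotient.exact h, hx⟩,
      fun ⟨h, hx⟩ => ⟨hx, Quotient.sound h⟩⟩
  exact this ▸ continuous_snd.isClosedMap _ (hs.inter (hK.preimage continuous_fst))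

/-- The quotient of a compact Hausdorff space by a closed equivalence relation is Hausdorff. -/
theorem t2Space_quotient_of_isClosed {s : Setoid Y}
    (hs : IsClosed {p : Y × Y | s p.1 p.2}) : T2Space (Quotient s) := by
  have hq := isClosedMap_quotientMk_of_isClosed hs
  have hfib (a : Quotient s) : IsClosed (Quotient.mk s ⁻¹' {a}) := by
    obtain ⟨y, rfl⟩ := Quotient.exists_rep a
    have := hq {y} isClosed_singleton
    rw [Set.image_singleton] at this
    exact this.preimage continuous_quotient_mk'
  have hker {U : Set Y} := isClosedMap_iff_kernImage.1 hq (u := U)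
  refine ⟨fun a b hab => ?_⟩
  obtain ⟨U, V, hU, hV, haU, hbV, hUV⟩ :=
    normal_separation (hfib a) (hfib b) (Disjoint.preimage _ (Set.disjoint_singleton.2 hab))
  refine ⟨_, _, hker hU, hker hV, fun y hy => haU hy, fun y hy => hbV hy, ?_⟩
  rw [Set.disjoint_left]
  intro c hcU hcV
  obtain ⟨y, rfl⟩ := Quotient.exists_rep c
  exact Set.disjoint_left.1 hUV (hcU rfl) (hcV rfl)

end QuotientTopology

namespace OverCompHaus

variable {X : CompHaus.{u}}

/-- The morphism of `Over X` determined by a continuous map commuting with the projections. -/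
def homOfMap {Y Z : Over X} (f : C(Y.left, Z.left)) (h : ∀ y, Z.hom (f y) = Y.hom y) : Y ⟶ Z :=
  Over.homMk (ConcreteCategory.ofHom f) (by ext y; exact h y)

theorem hom_left_apply {Y Z : Over X} (f : Y ⟶ Z) (y : Y.left) : Z.hom (f.left y) = Y.hom y :=
  ConcreteCategory.congr_hom (Over.w f) y

theorem comp_left_apply {Y Z W : Over X} (f : Y ⟶ Z) (g : Z ⟶ W) (y : Y.left) :
    (f ≫ g).left y = g.left (f.left y) := rfl

theorem hom_ext {Y Z : Over X} {f g : Y ⟶ Z} (h : ∀ y, f.left y = g.left y) : f = g :=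
  Over.OverMorphism.ext (by ext y; exact h y)

theorem continuous_left {Y Z : Over X} (f : Y ⟶ Z) : Continuous f.left :=
  (ConcreteCategory.hom f.left).continuous

theorem isClosed_range_left {Y Z : Over X} (f : Y ⟶ Z) : IsClosed (Set.range f.left) :=
  (isCompact_range (continuous_left f)).isClosed

/-- The one-point space over `x`. -/
def point (x : X) : Over X :=
  Over.mk (Y := CompHaus.of PUnit) (ConcreteCategory.ofHom (ContinuousMap.const _ x))

/-- A point of the fibre over `x`, as a morphism from `point x`. -/
def pointHom {Y : Over X} {x : X} (y : Y.left) (h : Y.hom y = x) : point x ⟶ Y :=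
  homOfMap (ContinuousMap.const _ y) fun _ => h

theorem injective_left_of_mono {Y Z : Over X} (f : Y ⟶ Z) [Mono f] :
    Function.Injective f.left := by
  intro a b hab
  have hx : Y.hom b = Y.hom a := by rw [← hom_left_apply f, ← hab, hom_left_apply]
  have : pointHom a rfl = pointHom b hx := by
    rw [← cancel_mono f]
    exact hom_ext fun _ => hab
  exact congrArg (fun g => g.left PUnit.unit) this

theorem mono_of_injective_left {Y Z : Over X} (f : Y ⟶ Z) (hf : Function.Injective f.left) :
    Mono f :=
  ⟨fun _ _ e => hom_ext fun w => hf (congrArg (fun k => k.left w) e)⟩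

theorem exists_fac_of_range_subset {Y Z W : Over X} (f : Y ⟶ Z) (m : W ⟶ Z) [Mono m]
    (h : Set.range f.left ⊆ Set.range m.left) : ∃ g : Y ⟶ W, g ≫ m = f := by
  have hm : Topology.IsClosedEmbedding m.left :=
    (continuous_left m).isClosedEmbedding (injective_left_of_mono m)
  choose g hg using fun y => h (Set.mem_range_self y)
  have hgc : Continuous g := hm.isInducing.continuous_iff.2 <| by
    convert continuous_left f using 1
    exact funext hg
  refine ⟨homOfMap ⟨g, hgc⟩ fun y => ?_, hom_ext hg⟩
  rw [← hom_left_apply m, ← hom_left_apply f y]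
  exact congrArg Z.hom (hg y)

theorem range_left_subset_of_fac {Y Z W : Over X} {f : Y ⟶ Z} {m : W ⟶ Z} {g : Y ⟶ W}
    (h : g ≫ m = f) : Set.range f.left ⊆ Set.range m.left := by
  rintro _ ⟨y, rfl⟩
  exact ⟨g.left y, by rw [← h, comp_left_apply]⟩

theorem exists_of_isPullback {P Y Z W : Over X} {p : P ⟶ Y} {q : P ⟶ Z} {f : Y ⟶ W} {g : Z ⟶ W}
    (h : IsPullback p q f g) {y : Y.left} {z : Z.left} (e : f.left y = g.left z) :
    ∃ t : P.left, p.left t = y ∧ q.left t = z := by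
  have hz : Z.hom z = Y.hom y := by rw [← hom_left_apply g, ← e, hom_left_apply]
  have w : pointHom y rfl ≫ f = pointHom z hz ≫ g := hom_ext fun _ => e
  exact ⟨(h.lift _ _ w).left PUnit.unit,
    congrArg (fun k => k.left PUnit.unit) (h.lift_fst _ _ w),
    congrArg (fun k => k.left PUnit.unit) (h.lift_snd _ _ w)⟩

theorem range_snd_left_of_isPullback {P Y Z W : Over X} {p : P ⟶ Y} {q : P ⟶ Z} {f : Y ⟶ W}
    {g : Z ⟶ W} (h : IsPullback p q f g) :
    Set.range q.left = g.left ⁻¹' Set.range f.left := by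
  ext z
  constructor
  · rintro ⟨t, rfl⟩
    exact ⟨p.left t, congrArg (fun k => k.left t) h.w⟩
  · rintro ⟨y, hy⟩
    obtain ⟨t, -, ht⟩ := exists_of_isPullback h hy
    exact ⟨t, ht⟩

/-- A closed subset of the total space, as an object over `X`. -/
def ofCloseds {Y : Over X} (K : TopologicalSpace.Closeds Y.left) : Over X :=
  haveI := isCompact_iff_compactSpace.1 K.isClosed.isCompact
  Over.mk (Y := CompHaus.of K)
    (ConcreteCategory.ofHom
      ((ConcreteCategory.hom Y.hom).comp ⟨Subtype.val, continuous_subtype_val⟩))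

/-- The inclusion of a closed subset of the total space. -/
def closedsInclusion {Y : Over X} (K : TopologicalSpace.Closeds Y.left) : ofCloseds K ⟶ Y :=
  homOfMap ⟨Subtype.val, continuous_subtype_val⟩ fun _ => rfl

instance {Y : Over X} (K : TopologicalSpace.Closeds Y.left) : Mono (closedsInclusion K) :=
  mono_of_injective_left _ Subtype.val_injective

theorem range_closedsInclusion_left {Y : Over X} (K : TopologicalSpace.Closeds Y.left) :
    Set.range (closedsInclusion K).left = K :=
  Subtype.range_val

theorem range_mk_arrow_left {Y Z : Over X} (m : Z ⟶ Y) [Mono m] :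
    Set.range (Subobject.mk m).arrow.left = Set.range m.left :=
  (range_left_subset_of_fac (Subobject.underlyingIso_hom_comp_eq_mk m)).antisymm
    (range_left_subset_of_fac (Subobject.underlyingIso_arrow m))

/-- Subobjects over `X` are the closed subsets of the total space. -/
noncomputable def subobjectIsoCloseds (Y : Over X) :
    Subobject Y ≃o TopologicalSpace.Closeds Y.left where
  toFun S := ⟨Set.range S.arrow.left, isClosed_range_left _⟩
  invFun K := Subobject.mk (closedsInclusion K)
  left_inv S := by
    apply le_antisymm
    · obtain ⟨g, hg⟩ := exists_fac_of_range_subset _ S.arrow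
        (range_closedsInclusion_left ⟨Set.range S.arrow.left, isClosed_range_left _⟩).subset
      exact Subobject.mk_le_of_comm g hg
    · obtain ⟨g, hg⟩ := exists_fac_of_range_subset S.arrow _
        (range_closedsInclusion_left ⟨Set.range S.arrow.left, isClosed_range_left _⟩).superset
      exact Subobject.le_mk_of_comm g hg
  right_inv K := TopologicalSpace.Closeds.ext <|
    (range_mk_arrow_left _).trans (range_closedsInclusion_left K)
  map_rel_iff' {S T} := by
    constructor
    · intro h
      obtain ⟨g, hg⟩ := exists_fac_of_range_subset S.arrow T.arrow h
      exact Subobject.le_of_comm g hg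
    · exact fun h => range_left_subset_of_fac (Subobject.ofLE_arrow h)

@[simp]
theorem coe_subobjectIsoCloseds {Y : Over X} (S : Subobject Y) :
    (subobjectIsoCloseds Y S : Set Y.left) = Set.range S.arrow.left := rfl

theorem wellPowered (X : CompHaus.{u}) : WellPowered.{max (u + 1) w} (Over X) where
  subobject_small _ := inferInstance

instance (X : CompHaus.{u}) : HasImages (Over X) where
  has_image {_ Z} f :=
    let K : TopologicalSpace.Closeds Z.left := ⟨Set.range f.left, isClosed_range_left f⟩
    have hK := exists_fac_of_range_subset f (closedsInclusion K)
      (range_closedsInclusion_left K).superset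
    have hlift (F : MonoFactorisation f) : ∃ g, g ≫ F.m = closedsInclusion K :=
      haveI := F.m_mono
      exists_fac_of_range_subset _ F.m
        ((range_closedsInclusion_left K).subset.trans (range_left_subset_of_fac F.fac))
    ⟨⟨⟨⟨_, closedsInclusion K, hK.choose, hK.choose_spec⟩,
      ⟨fun F => (hlift F).choose, fun F => (hlift F).choose_spec⟩⟩⟩⟩

theorem range_imageSubobject_arrow_left {Y Z : Over X} (f : Y ⟶ Z) :
    Set.range (imageSubobject f).arrow.left = Set.range f.left := by
  apply Set.Subset.antisymm
  · let K : TopologicalSpace.Closeds Z.left := ⟨Set.range f.left, isClosed_range_left f⟩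
    obtain ⟨g, hg⟩ := exists_fac_of_range_subset f (closedsInclusion K)
      (range_closedsInclusion_left K).superset
    have h := imageSubobject_le (X := Subobject.mk (closedsInclusion K)) f
      (g ≫ (Subobject.underlyingIso _).inv)
      (by rw [Category.assoc, Subobject.underlyingIso_arrow, hg])
    exact (range_left_subset_of_fac (Subobject.ofLE_arrow h)).trans
      ((range_mk_arrow_left _).trans (range_closedsInclusion_left K)).subset
  · exact range_left_subset_of_fac (imageSubobject_arrow_comp f)

theorem stableImages (X : CompHaus.{u}) : StableImages (Over X) where
  image_pullback f g := by
    apply (subobjectIsoCloseds _).injective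
    apply TopologicalSpace.Closeds.ext
    rw [coe_subobjectIsoCloseds, coe_subobjectIsoCloseds, range_imageSubobject_arrow_left,
      range_snd_left_of_isPullback (Subobject.isPullback g _), range_imageSubobject_arrow_left,
      range_snd_left_of_isPullback (IsPullback.of_hasPullback f g)]

theorem exists_desc_of_surjective {Y Z V : Over X} (q : Y ⟶ Z)
    (hq : Function.Surjective q.left) (k : Y ⟶ V)
    (hk : ∀ a b, q.left a = q.left b → k.left a = k.left b) : ∃ g : Z ⟶ V, q ≫ g = k := by
  have hqm : Topology.IsQuotientMap q.left :=
    (continuous_left q).isClosedMap.isQuotientMap (continuous_left q) hq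
  choose σ hσ using hq
  have hg (y : Y.left) : k.left (σ (q.left y)) = k.left y := hk _ _ (hσ _)
  have hgc : Continuous fun z => k.left (σ z) := hqm.continuous_iff.2 <| by
    convert continuous_left k using 1
    exact funext hg
  refine ⟨homOfMap ⟨fun z => k.left (σ z), hgc⟩ fun z => ?_, hom_ext hg⟩
  change V.hom (k.left (σ z)) = Z.hom z
  rw [hom_left_apply, ← hom_left_apply q, hσ]

/-- A surjection over `X` is the coequaliser of any pair inducing its kernel relation. -/
theorem nonempty_isColimit_cofork {W Y Z : Over X} {l r : W ⟶ Y} {q : Y ⟶ Z}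
    (w : l ≫ q = r ≫ q) (hq : Function.Surjective q.left)
    (h : ∀ a b, q.left a = q.left b → ∃ t, l.left t = a ∧ r.left t = b) :
    Nonempty (IsColimit (Cofork.ofπ q w)) := by
  have hdesc (s : Cofork l r) : ∃ g, q ≫ g = s.π :=
    exists_desc_of_surjective q hq s.π fun a b hab => by
      obtain ⟨t, rfl, rfl⟩ := h a b hab
      exact congrArg (fun k => k.left t) s.condition
  refine ⟨Cofork.IsColimit.mk _ (fun s => (hdesc s).choose) (fun s => (hdesc s).choose_spec)
    fun s m hm => hom_ext fun z => ?_⟩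
  obtain ⟨y, rfl⟩ := hq z
  exact congrArg (fun k => k.left y) (hm.trans (hdesc s).choose_spec.symm)

theorem nonempty_regularEpi_of_surjective {Y Z : Over X} (q : Y ⟶ Z)
    (hq : Function.Surjective q.left) : Nonempty (RegularEpi q) := by
  obtain ⟨h⟩ := nonempty_isColimit_cofork (pullback.condition (f := q) (g := q)) hq
    fun _ _ hab => exists_of_isPullback (IsPullback.of_hasPullback q q) hab
  exact ⟨⟨_, _, _, _, h⟩⟩

section EquivRel

variable {R Y : Over X} {r₁ r₂ : R ⟶ Y}

theorem exists_pointHom_iff {x : X} {a b : Y.left} (ha : Y.hom a = x) (hb : Y.hom b = x) :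
    (∃ h : point x ⟶ R, h ≫ r₁ = pointHom a ha ∧ h ≫ r₂ = pointHom b hb) ↔
      ∃ t, r₁.left t = a ∧ r₂.left t = b := by
  constructor
  · rintro ⟨h, h₁, h₂⟩
    exact ⟨h.left PUnit.unit, congrArg (fun k => k.left PUnit.unit) h₁,
      congrArg (fun k => k.left PUnit.unit) h₂⟩
  · rintro ⟨t, rfl, rfl⟩
    exact ⟨pointHom t ((hom_left_apply r₁ t).symm.trans ha), rfl, rfl⟩

theorem hom_eq_of_rel {a b : Y.left} (h : ∃ t, r₁.left t = a ∧ r₂.left t = b) :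
    Y.hom b = Y.hom a := by
  obtain ⟨t, rfl, rfl⟩ := h
  rw [hom_left_apply, hom_left_apply]

/-- The equivalence relation on the total space given by an internal equivalence relation. -/
def setoidOfEquivRel (hR : IsEquivRelPair r₁ r₂) : Setoid Y.left where
  r a b := ∃ t, r₁.left t = a ∧ r₂.left t = b
  iseqv :=
    { refl := fun a => (exists_pointHom_iff rfl rfl).1 (hR.refl (pointHom a rfl))
      symm := fun {_ _} h => (exists_pointHom_iff (hom_eq_of_rel h) rfl).1
        (hR.symm _ _ ((exists_pointHom_iff rfl (hom_eq_of_rel h)).2 h))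
      trans := fun {_ _ _} h h' =>
        have hc := (hom_eq_of_rel h').trans (hom_eq_of_rel h)
        (exists_pointHom_iff rfl hc).1 (hR.trans _ _ _
          ((exists_pointHom_iff rfl (hom_eq_of_rel h)).2 h)
          ((exists_pointHom_iff (hom_eq_of_rel h) hc).2 h')) }

theorem isClosedEmbedding_of_equivRel (hR : IsEquivRelPair r₁ r₂) :
    Topology.IsClosedEmbedding fun t => (r₁.left t, r₂.left t) := by
  refine ((continuous_left r₁).prodMk (continuous_left r₂)).isClosedEmbedding fun s t hst => ?_
  obtain ⟨h₁, h₂⟩ := Prod.ext_iff.1 hst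
  have hx : R.hom t = R.hom s := by
    rw [← hom_left_apply r₁, ← hom_left_apply r₁ s]
    exact congrArg Y.hom h₁.symm
  exact congrArg (fun k => k.left PUnit.unit)
    (hR.jointlyMono (pointHom s rfl) (pointHom t hx) (hom_ext fun _ => h₁) (hom_ext fun _ => h₂))

theorem isClosed_setoidOfEquivRel (hR : IsEquivRelPair r₁ r₂) :
    IsClosed {p : Y.left × Y.left | setoidOfEquivRel hR p.1 p.2} := by
  convert (isClosedEmbedding_of_equivRel hR).isClosed_range
  ext ⟨a, b⟩
  exact exists_congr fun _ => Prod.mk_inj.symm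

/-- The quotient of an object over `X` by an internal equivalence relation. -/
def quotientObj (hR : IsEquivRelPair r₁ r₂) : Over X :=
  haveI := t2Space_quotient_of_isClosed (isClosed_setoidOfEquivRel hR)
  Over.mk (Y := CompHaus.of (Quotient (setoidOfEquivRel hR)))
    (ConcreteCategory.ofHom ⟨Quotient.lift Y.hom fun _ _ h => (hom_eq_of_rel h).symm,
      (ConcreteCategory.hom Y.hom).continuous.quotient_lift _⟩)

/-- The quotient map of an internal equivalence relation. -/
def quotientMap (hR : IsEquivRelPair r₁ r₂) : Y ⟶ quotientObj hR :=
  homOfMap ⟨Quotient.mk _, continuous_quotient_mk'⟩ fun _ => rfl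

theorem quotientMap_left_eq_iff (hR : IsEquivRelPair r₁ r₂) {a b : Y.left} :
    (quotientMap hR).left a = (quotientMap hR).left b ↔ ∃ t, r₁.left t = a ∧ r₂.left t = b :=
  Quotient.eq

theorem nonempty_isLimit_of_equivRel (hR : IsEquivRelPair r₁ r₂) {Z : Over X} {q : Y ⟶ Z}
    (w : r₁ ≫ q = r₂ ≫ q)
    (h : ∀ a b, q.left a = q.left b → ∃ t, r₁.left t = a ∧ r₂.left t = b) :
    Nonempty (IsLimit (PullbackCone.mk r₁ r₂ w)) := by
  have hlift (s : PullbackCone q q) : ∃ g : s.pt ⟶ R, g ≫ r₁ = s.fst ∧ g ≫ r₂ = s.snd := by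
    choose g hg₁ hg₂ using fun a => h _ _ (congrArg (fun k => k.left a) s.condition)
    have hgc : Continuous g := (isClosedEmbedding_of_equivRel hR).isInducing.continuous_iff.2 <| by
      convert (continuous_left s.fst).prodMk (continuous_left s.snd) using 1
      exact funext fun a => Prod.ext (hg₁ a) (hg₂ a)
    refine ⟨homOfMap ⟨g, hgc⟩ fun a => ?_, hom_ext hg₁, hom_ext hg₂⟩
    rw [← hom_left_apply r₁, ← hom_left_apply s.fst a]
    exact congrArg Y.hom (hg₁ a)
  exact ⟨PullbackCone.IsLimit.mk w (fun s => (hlift s).choose)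
    (fun s => (hlift s).choose_spec.1) (fun s => (hlift s).choose_spec.2)
    fun s m h₁ h₂ => hR.jointlyMono _ _ (h₁.trans (hlift s).choose_spec.1.symm)
      (h₂.trans (hlift s).choose_spec.2.symm)⟩

end EquivRel

theorem effectiveEquivRels (X : CompHaus.{u}) : EffectiveEquivRels (Over X) := by
  intro R Y r₁ r₂ hR
  have w : r₁ ≫ quotientMap hR = r₂ ≫ quotientMap hR :=
    hom_ext fun t => (quotientMap_left_eq_iff hR).2 ⟨t, rfl, rfl⟩
  have hker := fun a b => (quotientMap_left_eq_iff hR (a := a) (b := b)).1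
  exact ⟨_, quotientMap hR, w, nonempty_isColimit_cofork w Quotient.exists_rep hker,
    nonempty_isLimit_of_equivRel hR w hker⟩

theorem finitaryExtensive (X : CompHaus.{u}) : FinitaryExtensive (Over X) :=
  have : CompHausLike.HasExplicitFiniteCoproducts.{0, u} (fun _ : TopCat.{u} => True) :=
    ⟨fun _ => inferInstance⟩
  have : FinitaryExtensive CompHaus.{u} :=
    CompHausLike.finitaryExtensive fun _ _ _ _ _ _ => inferInstance
  finitaryExtensive_of_preserves_and_reflects (Over.forget X)

theorem isComplementedSub_iff {Y : Over X} (S : Subobject Y) :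
    IsComplementedSub S ↔ IsOpen (subobjectIsoCloseds Y S : Set Y.left) := by
  set e := subobjectIsoCloseds Y
  constructor
  · rintro ⟨T, m, hm, hbot, htop⟩
    rw [← e.isGLB_image', Set.image_pair] at hm
    rw [← e.isLUB_image', Set.image_pair, e.map_top] at htop
    have hm_bot : e m = ⊥ := le_bot_iff.1 (e.le_symm_apply.1 (hbot _))
    have hinf := congrArg SetLike.coe ((isGLB_pair.unique hm).trans hm_bot)
    have hsup := congrArg SetLike.coe (isLUB_pair.unique htop)
    have hcompl : IsCompl (e S : Set Y.left) (e T) := IsCompl.of_eq hinf hsup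
    rw [← isClosed_compl_iff, hcompl.compl_eq]
    exact (e T).isClosed
  · intro h
    let T : TopologicalSpace.Closeds Y.left := ⟨_, h.isClosed_compl⟩
    refine ⟨e.symm T, e.symm ⊥, ?_, fun U => e.symm_apply_le.2 bot_le, ?_⟩
    · rw [← e.isGLB_image, Set.image_pair, e.apply_symm_apply]
      convert isGLB_pair
      exact TopologicalSpace.Closeds.ext (Set.inter_compl_self _).symm
    · rw [← e.isLUB_image', Set.image_pair, e.apply_symm_apply, e.map_top]
      convert isLUB_pair
      exact TopologicalSpace.Closeds.ext (Set.union_compl_self _).symm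

/-- The clopen subobjects containing a closed subset of the total space. -/
noncomputable def centerFilterOfCloseds {Y : Over X} (K : TopologicalSpace.Closeds Y.left) :
    CenterFilter Y where
  carrier := {S | IsComplementedSub S ∧ K ≤ subobjectIsoCloseds Y S}
  mem_complemented _ h := h.1
  nonempty := ⟨⊤, by
    rw [Set.mem_ofPred_eq, isComplementedSub_iff, OrderIso.map_top]
    exact ⟨isOpen_univ, le_top⟩⟩
  inf_mem S hS T hT m hm := by
    rw [← (subobjectIsoCloseds Y).isGLB_image', Set.image_pair] at hm
    rw [Set.mem_ofPred_eq, isComplementedSub_iff, hm.unique isGLB_pair]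
    exact ⟨((isComplementedSub_iff S).1 hS.1).inter ((isComplementedSub_iff T).1 hT.1),
      le_inf hS.2 hT.2⟩
  mem_of_le _ hS _ hT h := ⟨hT, hS.2.trans ((subobjectIsoCloseds Y).monotone h)⟩

theorem centerFilterOfCloseds_le_iff {Y : Over X} [TotallyDisconnectedSpace Y.left]
    {K L : TopologicalSpace.Closeds Y.left} :
    centerFilterOfCloseds K ≤ centerFilterOfCloseds L ↔ K ≤ L := by
  refine ⟨fun h x hxK => ?_, fun h S hS => ⟨hS.1, h.trans hS.2⟩⟩
  by_contra hxL
  obtain ⟨V, hV, hxV, hVL⟩ := compact_exists_isClopen_in_isOpen L.isClosed.isOpen_compl hxL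
  let e := subobjectIsoCloseds Y
  let W : TopologicalSpace.Closeds Y.left := ⟨Vᶜ, hV.compl.isClosed⟩
  have hW : e (e.symm W) = W := e.apply_symm_apply W
  have hmem : e.symm W ∈ (centerFilterOfCloseds L).carrier := by
    refine ⟨(isComplementedSub_iff _).2 ?_, ?_⟩
    · exact hW.symm ▸ hV.compl.isOpen
    · exact hW.symm ▸ fun y hy hyV => hVL hyV hy
  have hKW : K ≤ W := hW ▸ (h hmem).2
  exact hKW hxK hxV

theorem centerFilterOfCloseds_surjective (Y : Over X) :
    Function.Surjective (centerFilterOfCloseds (Y := Y)) := by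
  intro F
  let e := subobjectIsoCloseds Y
  let K : TopologicalSpace.Closeds Y.left :=
    ⟨⋂ S : F.carrier, e S, isClosed_iInter fun S => (e S).isClosed⟩
  refine ⟨K, CenterFilter.ext' (Set.Subset.antisymm ?_ ?_)⟩
  · rintro T ⟨hT, hKT⟩
    have hTopen := (isComplementedSub_iff T).1 hT
    have := F.nonempty.to_subtype
    obtain ⟨S, hS⟩ := hTopen.isClosed_compl.isCompact.elim_directed_family_closed
      (fun S : F.carrier => (e S : Set Y.left)) (fun S => (e S).isClosed)
      (Set.disjoint_iff_inter_eq_empty.1 (Set.disjoint_compl_left_iff_subset.2 hKT))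
      fun S S' => by
        have hm : IsGLB {S.1, S'.1} (e.symm (e S ⊓ e S')) := by
          rw [← e.isGLB_image, Set.image_pair]
          exact isGLB_pair
        exact ⟨⟨_, F.inf_mem _ S.2 _ S'.2 _ hm⟩, e.monotone (hm.1 (Set.mem_insert _ _)),
          e.monotone (hm.1 (Set.mem_insert_of_mem _ rfl))⟩
    refine F.mem_of_le S S.2 T hT (e.le_iff_le.1 ?_)
    exact Set.disjoint_compl_left_iff_subset.1 (Set.disjoint_iff_inter_eq_empty.2 hS)
  · exact fun S hS => ⟨F.mem_complemented S hS,
      Set.iInter_subset (fun S : F.carrier => (e S : Set Y.left)) ⟨S, hS⟩⟩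

theorem filtralObject_of_totallyDisconnectedSpace (Y : Over X)
    [TotallyDisconnectedSpace Y.left] : FiltralObject Y :=
  ⟨(subobjectIsoCloseds Y).trans <| RelIso.ofSurjective
    (OrderEmbedding.ofMapLEIff centerFilterOfCloseds fun _ _ => centerFilterOfCloseds_le_iff)
    (centerFilterOfCloseds_surjective Y)⟩

theorem filtral (X : CompHaus.{u}) : Filtral (Over X) := by
  intro Y
  let p : C(Ultrafilter Y.left, Y.left) :=
    ⟨Ultrafilter.extend id, continuous_ultrafilter_extend id⟩
  let S : Over X := Over.mk (Y := CompHaus.of (Ultrafilter Y.left))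
    (ConcreteCategory.ofHom ((ConcreteCategory.hom Y.hom).comp p))
  let f : S ⟶ Y := homOfMap p fun _ => rfl
  have : TotallyDisconnectedSpace S.left :=
    inferInstanceAs (TotallyDisconnectedSpace (Ultrafilter Y.left))
  refine ⟨S, f, nonempty_regularEpi_of_surjective f fun y => ⟨pure y, ?_⟩,
    filtralObject_of_totallyDisconnectedSpace S⟩
  exact congrFun (ultrafilter_extend_extends id) y

theorem nonTrivialCat (X : CompHaus.{u}) [Nonempty X] : NonTrivialCat (Over X) := by
  intro Z hI hT
  let E : Over X := Over.mk (Y := CompHaus.of PEmpty)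
    (ConcreteCategory.ofHom ⟨PEmpty.elim, continuous_of_const fun x => x.elim⟩)
  let f : Over.mk (𝟙 X) ⟶ E := hT.from _ ≫ hI.to E
  exact (f.left (Classical.arbitrary X)).elim

theorem not_wellPointed (X : CompHaus.{u}) (hX : ∃ x y : X, x ≠ y) : ¬ WellPointed (Over X) := by
  obtain ⟨x, y, hxy⟩ := hX
  intro h
  let B : Over X := Over.mk (Y := CompHaus.of (ULift Bool))
    (ConcreteCategory.ofHom (ContinuousMap.const _ x))
  have key := h (pointHom (Y := B) (x := x) ⟨true⟩ rfl)
    (pointHom (Y := B) (x := x) ⟨false⟩ rfl) fun p =>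
      absurd (hom_left_apply (terminal.from (Over.mk (𝟙 X)) ≫ p) y) hxy
  exact absurd (congrArg (fun k => (k.left PUnit.unit).down) key) Bool.noConfusion

end OverCompHaus

/-- For a compact Hausdorff space `X` with at least two points, `KH/X` is a non-trivial
pretopos which is filtral and has all set-indexed coproducts, but is not well-pointed. -/
theorem slice_filtral_pretopos_not_wellPointed (X : CompHaus.{u})
    (hX : ∃ x y : X, x ≠ y) :
    NonTrivialCat (Over X) ∧
      WellPowered (Over X) ∧
      (∃ (h1 : HasFiniteLimits (Over X)) (h2 : HasImages (Over X)),
        @StableImages (Over X) _ h1 h2) ∧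
      EffectiveEquivRels (Over X) ∧
      FinitaryExtensive (Over X) ∧
      Filtral (Over X) ∧
      (∀ (I : Type u) (f : I → Over X), HasCoproduct f) ∧
      ¬ WellPointed (Over X) :=
  have : Nonempty X := ⟨hX.choose⟩
  ⟨OverCompHaus.nonTrivialCat X, OverCompHaus.wellPowered X,
    ⟨inferInstance, inferInstance, OverCompHaus.stableImages X⟩,
    OverCompHaus.effectiveEquivRels X, OverCompHaus.finitaryExtensive X, OverCompHaus.filtral X,
    fun _ _ => inferInstance, OverCompHaus.not_wellPointed X hX⟩

end Paper
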